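/- Optimality of Schmidt-value truncation (Eckart–Young for the Frobenius norm): let a : Fin r → (Fin m → ℂ) and b : Fin r → (Fin n → ℂ) be orthonormal families, let λ : Fin r → ℝ be nonnegative and antitone (λ 0 ≥ λ 1 ≥ ⋯ ≥ 0), and let M := ∑_{k} (λ k : ℂ) • vecMulVec (a k) (fun j => conj (b k j)) be the corresponding matrix (i.e. M has singular value decomposition with singular values λ). Then for every t ≤ r, the truncation M_t := ∑_{k < t} (λ k : ℂ) • vecMulVec (a k) (fun j => conj (b k j)) satisfies ‖M - M_t‖_F ≤ ‖M - X‖_F for every matrix X : Matrix (Fin m) (Fin n) ℂ with Matrix.rank X ≤ t; equivalently, the state obtained by keeping the t largest Schmidt values minimizes the 2-norm distance to the original state among all states of Schmidt rank at most t. -/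

import Mathlib

open Matrix

/-- The standard Hermitian inner product `⟨u, v⟩ = ∑ i, conj (u i) * v i`. -/
noncomputable def hinner {ι : Type*} [Fintype ι] (u v : ι → ℂ) : ℂ :=
  ∑ i, (starRingEnd ℂ) (u i) * v i

/-- The Frobenius norm of a complex matrix. -/
noncomputable def frobNorm {m n : Type*} [Fintype m] [Fintype n]
    (M : Matrix m n ℂ) : ℝ :=
  Real.sqrt (∑ i, ∑ j, Complex.normSq (M i j))

open scoped InnerProductSpace

/-- Parseval identity for vector-valued coefficients along a family that is orthonormal for
`hinner`. -/
theorem sum_norm_sq_sum_conj_smul {ι κ E : Type*} [Fintype ι] [Fintype κ] [DecidableEq κ]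
    [NormedAddCommGroup E] [InnerProductSpace ℂ E] (b : κ → ι → ℂ)
    (hb : ∀ k l, hinner (b k) (b l) = if k = l then 1 else 0) (v : κ → E) :
    ∑ j, ‖∑ k, (starRingEnd ℂ) (b k j) • v k‖ ^ 2 = ∑ k, ‖v k‖ ^ 2 := by
  have h : ∀ j, ((‖∑ k, (starRingEnd ℂ) (b k j) • v k‖ ^ 2 : ℝ) : ℂ)
      = ∑ k, ∑ l, ((starRingEnd ℂ) (b l j) * b k j) * ⟪v k, v l⟫_ℂ := by
    intro j
    push_cast
    rw [← Complex.coe_algebraMap, ← inner_self_eq_norm_sq_to_K (𝕜 := ℂ), sum_inner]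
    refine Finset.sum_congr rfl fun k _ => ?_
    rw [inner_sum]
    refine Finset.sum_congr rfl fun l _ => ?_
    rw [inner_smul_left, inner_smul_right, Complex.conj_conj]
    ring
  apply Complex.ofReal_injective
  rw [Complex.ofReal_sum, Complex.ofReal_sum, Finset.sum_congr rfl fun j _ => h j,
    Finset.sum_comm]
  refine Finset.sum_congr rfl fun k _ => ?_
  rw [Finset.sum_comm]
  have h' : ∀ l, ∑ j, ((starRingEnd ℂ) (b l j) * b k j) * ⟪v k, v l⟫_ℂ
      = if l = k then ⟪v k, v l⟫_ℂ else 0 := by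
    intro l
    rw [← Finset.sum_mul]
    change hinner (b l) (b k) * _ = _
    rw [hb]
    split_ifs <;> simp
  simp only [h', Finset.sum_ite_eq', Finset.mem_univ, if_true]
  rw [inner_self_eq_norm_sq_to_K]
  simp

/-- An orthonormal family has total squared overlap at most `dim W` with a subspace `W`. -/
theorem Orthonormal.sum_norm_sq_starProjection_le {κ E : Type*} [Fintype κ]
    [NormedAddCommGroup E] [InnerProductSpace ℂ E] {a : κ → E} (ha : Orthonormal ℂ a)
    (W : Submodule ℂ E) [FiniteDimensional ℂ W] :
    ∑ k, ‖W.starProjection (a k)‖ ^ 2 ≤ Module.finrank ℂ W := by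
  let u := stdOrthonormalBasis ℂ W
  have h : ∀ k, ‖W.starProjection (a k)‖ ^ 2 = ∑ i, ‖⟪a k, (u i : E)⟫_ℂ‖ ^ 2 := by
    intro k
    rw [Submodule.starProjection_apply, ← Submodule.coe_norm, ← u.sum_sq_norm_inner_right]
    refine Finset.sum_congr rfl fun i _ => ?_
    rw [Submodule.inner_orthogonalProjectionOnto_eq_of_mem_left, norm_inner_symm]
  simp only [h]
  rw [Finset.sum_comm]
  calc ∑ i, ∑ k, ‖⟪a k, (u i : E)⟫_ℂ‖ ^ 2 ≤ ∑ _i : Fin (Module.finrank ℂ W), (1 : ℝ) := by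
        refine Finset.sum_le_sum fun i _ => ?_
        refine (ha.sum_inner_products_le (u i : E)).trans ?_
        rw [← Submodule.coe_norm, u.norm_eq_one, one_pow]
    _ = _ := by simp

/-- Removing weights `c k ∈ [0, 1]` of total mass at most `t` from an antitone nonnegative
sequence leaves at least the tail of the sequence after its first `t` terms. -/
theorem Antitone.sum_tail_le_sum_mul_one_sub {r : ℕ} {w : Fin r → ℝ} (hw : Antitone w)
    (hw0 : ∀ k, 0 ≤ w k) {t : ℕ} (ht : t ≤ r) {c : Fin r → ℝ} (hc0 : ∀ k, 0 ≤ c k)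
    (hc1 : ∀ k, c k ≤ 1) (hc : ∑ k, c k ≤ t) :
    ∑ k, (if k.1 < t then 0 else w k) ≤ ∑ k, w k * (1 - c k) := by
  obtain ⟨L, hL0, hL1, hL2⟩ : ∃ L : ℝ, 0 ≤ L ∧ (∀ k : Fin r, k.1 < t → L ≤ w k) ∧
      ∀ k : Fin r, ¬ k.1 < t → w k ≤ L := by
    rcases ht.lt_or_eq with h | rfl
    · exact ⟨w ⟨t, h⟩, hw0 _, fun k hk => hw (Fin.le_def.2 hk.le),
        fun k hk => hw (Fin.le_def.2 (not_lt.1 hk))⟩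
    · exact ⟨0, le_rfl, fun k _ => hw0 k, fun k hk => absurd k.2 hk⟩
  have hcard : ∑ k : Fin r, (if k.1 < t then (1 : ℝ) else 0) = t := by
    rw [Finset.sum_boole, Fin.card_filter_val_lt, min_eq_right ht]
  have hterm : ∀ k : Fin r, (if k.1 < t then 0 else w k)
      + L * ((if k.1 < t then (1 : ℝ) else 0) - c k) ≤ w k * (1 - c k) := by
    intro k
    split_ifs with hk
    · have := mul_le_mul_of_nonneg_right (hL1 k hk) (sub_nonneg.2 (hc1 k))
      linarith
    · have := mul_le_mul_of_nonneg_right (hL2 k hk) (hc0 k)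
      linarith
  have hsum := Finset.sum_le_sum fun k (_ : k ∈ Finset.univ) => hterm k
  rw [Finset.sum_add_distrib, ← Finset.mul_sum, Finset.sum_sub_distrib, hcard] at hsum
  have := mul_nonneg hL0 (sub_nonneg.2 hc)
  linarith

/-- The squared Frobenius norm is the sum of the squared Euclidean norms of the columns. -/
theorem sum_normSq_eq_sum_norm_sq_col {m n : Type*} [Fintype m] [Fintype n]
    (A : Matrix m n ℂ) :
    ∑ i, ∑ j, Complex.normSq (A i j) = ∑ j, ‖WithLp.toLp 2 (A.col j)‖ ^ 2 := by
  rw [Finset.sum_comm]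
  refine Finset.sum_congr rfl fun j _ => ?_
  rw [EuclideanSpace.norm_sq_eq]
  simp [Complex.normSq_eq_norm_sq]

theorem toLp_col_sum_smul_vecMulVec {ι κ μ : Type*} [Fintype κ] [Fintype μ]
    (w : κ → ℂ) (a : κ → μ → ℂ) (b : κ → ι → ℂ) (j : ι) :
    WithLp.toLp 2 ((∑ k, w k • vecMulVec (a k) (fun j => (starRingEnd ℂ) (b k j))).col j)
      = ∑ k, (starRingEnd ℂ) (b k j) • w k • WithLp.toLp 2 (a k) := by
  ext i
  simp only [Matrix.col_apply, Matrix.sum_apply, Matrix.smul_apply, vecMulVec_apply,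
    WithLp.ofLp_sum, WithLp.ofLp_smul, Finset.sum_apply, Pi.smul_apply, smul_eq_mul]
  exact Finset.sum_congr rfl fun k _ => by ring

theorem orthonormal_toLp_of_hinner {κ μ : Type*} [Fintype μ] [DecidableEq κ] {a : κ → μ → ℂ}
    (ha : ∀ k l, hinner (a k) (a l) = if k = l then 1 else 0) :
    Orthonormal ℂ fun k => WithLp.toLp 2 (a k) := by
  rw [orthonormal_iff_ite]
  intro k l
  rw [← ha, hinner, PiLp.inner_apply]
  exact Finset.sum_congr rfl fun i _ => by simp [mul_comm]

/-- The span of the columns, seen in Euclidean space, has dimension the rank. -/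
theorem finrank_span_toLp_col {m n : Type*} [Fintype m] [Fintype n] (X : Matrix m n ℂ) :
    Module.finrank ℂ (Submodule.span ℂ (Set.range fun j => WithLp.toLp 2 (X.col j)))
      = X.rank := by
  rw [Matrix.rank_eq_finrank_span_cols,
    ← LinearEquiv.finrank_map_eq (WithLp.linearEquiv 2 ℂ (m → ℂ)).symm, Submodule.map_span,
    ← Set.range_comp]
  rfl

/-- Optimality of Schmidt-value truncation (Eckart–Young for the Frobenius norm):
given a singular value decomposition `M = ∑_k λ_k a_k b_kᴴ` with orthonormal families
`a`, `b` and nonnegative antitone singular values `λ`, the truncation keeping the `t`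
largest singular values minimizes the Frobenius distance to `M` among all matrices of
rank at most `t`. -/
theorem schmidt_truncation_optimal {r m n : ℕ}
    (a : Fin r → (Fin m → ℂ)) (b : Fin r → (Fin n → ℂ))
    (ha : ∀ k l, hinner (a k) (a l) = if k = l then 1 else 0)
    (hb : ∀ k l, hinner (b k) (b l) = if k = l then 1 else 0)
    (lam : Fin r → ℝ) (hnonneg : ∀ k, 0 ≤ lam k) (hmono : Antitone lam)
    (M : Matrix (Fin m) (Fin n) ℂ)
    (hM : M = ∑ k : Fin r,
      (lam k : ℂ) • vecMulVec (a k) (fun j => (starRingEnd ℂ) (b k j)))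
    (t : ℕ) (ht : t ≤ r)
    (Mt : Matrix (Fin m) (Fin n) ℂ)
    (hMt : Mt = ∑ k ∈ Finset.univ.filter (fun k : Fin r => k.1 < t),
      (lam k : ℂ) • vecMulVec (a k) (fun j => (starRingEnd ℂ) (b k j))) :
    ∀ X : Matrix (Fin m) (Fin n) ℂ, X.rank ≤ t →
      frobNorm (M - Mt) ≤ frobNorm (M - X) := by
  intro X hX
  have hao := orthonormal_toLp_of_hinner ha
  let W := Submodule.span ℂ (Set.range fun j => WithLp.toLp 2 (X.col j))
  let Q := Wᗮ.starProjection
  have hpyth : ∀ x, ‖Q x‖ ^ 2 = ‖x‖ ^ 2 - ‖W.starProjection x‖ ^ 2 := fun x => by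
    rw [W.norm_sq_eq_add_norm_sq_starProjection x]
    ring
  have hQa : ∀ k, ‖Q (WithLp.toLp 2 (a k))‖ ^ 2
      = 1 - ‖W.starProjection (WithLp.toLp 2 (a k))‖ ^ 2 := fun k => by
    rw [hpyth, hao.norm_eq_one, one_pow]
  have htail : M - Mt = ∑ k : Fin r, ((if k.1 < t then 0 else lam k : ℝ) : ℂ) •
      vecMulVec (a k) (fun j => (starRingEnd ℂ) (b k j)) := by
    rw [hM, hMt, Finset.sum_filter, ← Finset.sum_sub_distrib]
    refine Finset.sum_congr rfl fun k _ => ?_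
    split_ifs <;> simp
  refine Real.sqrt_le_sqrt ?_
  rw [sum_normSq_eq_sum_norm_sq_col, sum_normSq_eq_sum_norm_sq_col]
  calc ∑ j, ‖WithLp.toLp 2 ((M - Mt).col j)‖ ^ 2
      = ∑ k : Fin r, (if k.1 < t then 0 else lam k ^ 2) := by
        simp only [htail, toLp_col_sum_smul_vecMulVec]
        rw [sum_norm_sq_sum_conj_smul b hb]
        refine Finset.sum_congr rfl fun k _ => ?_
        rw [norm_smul, hao.norm_eq_one]
        split_ifs <;> simp
    _ ≤ ∑ k, lam k ^ 2 * (1 - ‖W.starProjection (WithLp.toLp 2 (a k))‖ ^ 2) := by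
        refine Antitone.sum_tail_le_sum_mul_one_sub
          (fun k l hkl => pow_le_pow_left₀ (hnonneg l) (hmono hkl) 2)
          (fun k => sq_nonneg _) ht (fun k => sq_nonneg _)
          (fun k => sub_nonneg.1 (hQa k ▸ sq_nonneg _)) ?_
        refine (hao.sum_norm_sq_starProjection_le W).trans ?_
        rw [finrank_span_toLp_col]
        exact_mod_cast hX
    _ = ∑ j, ‖Q (WithLp.toLp 2 (M.col j))‖ ^ 2 := by
        simp only [hM, toLp_col_sum_smul_vecMulVec, map_sum, map_smul]
        rw [sum_norm_sq_sum_conj_smul b hb]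
        refine Finset.sum_congr rfl fun k _ => ?_
        rw [norm_smul, mul_pow, hQa]
        simp
    _ = ∑ j, ‖Q (WithLp.toLp 2 ((M - X).col j))‖ ^ 2 := by
        refine Finset.sum_congr rfl fun j _ => ?_
        have hXj : Q (WithLp.toLp 2 (X.col j)) = 0 := by
          rw [Submodule.starProjection_apply_eq_zero_iff, Submodule.orthogonal_orthogonal]
          exact Submodule.subset_span ⟨j, rfl⟩
        have hsub : WithLp.toLp 2 ((M - X).col j)
            = WithLp.toLp 2 (M.col j) - WithLp.toLp 2 (X.col j) := rfl
        rw [hsub, map_sub, hXj, sub_zero]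
    _ ≤ ∑ j, ‖WithLp.toLp 2 ((M - X).col j)‖ ^ 2 := by
        refine Finset.sum_le_sum fun j _ => ?_
        rw [hpyth]
        exact sub_le_self _ (sq_nonneg _)
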